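/- arXiv:1306.4520 — 2 statements merged into one kernel-verified Lean document; each statement's English description precedes it below -/
import Mathlib

section
/- Kernel estimate for the exponential-polynomial weight: Let γ > 0, θ ≥ 0, λ ∈ ℝ, T > 0 and φ̂(x,t) = θ e^{−λt}(|x|^{2γ+2} + 1). Let η : ℝ^N×ℝ×ℝ^l → ℝ^N satisfy |η_k(x,t,z)| ≤ B̃ min{|z|,1} for all k, for some B̃ ≥ 1, and for z ∈ ℝ^l∖{0} set K(x,t,z) = φ̂(x + η(x,t,z), t) − φ̂(x,t) − 1_{{|z|≤1}}(z)·Σ_{k=1}^N η_k(x,t,z) ∂_{x_k}φ̂(x,t). Then there is a constant c ≥ 1 depending only on N, B̃ and γ (in particular independent of θ, λ, t and x) such that |K(x,t,z)| ≤ c|z|²·φ̂(x,t) whenever 0 < |z| ≤ 1, and |K(x,t,z)| ≤ c·φ̂(x,t) whenever |z| > 1, for all (x,t) ∈ ℝ^N×[0,T]. -/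
open Set

noncomputable section

abbrev Euc (n : ℕ) : Type := EuclideanSpace ℝ (Fin n)

/-- Spatial partial derivative `∂_{x_k} φ(x,t)`. -/
noncomputable def pd1 {N : ℕ} (φ : Euc N → ℝ → ℝ) (x : Euc N) (t : ℝ) (k : Fin N) : ℝ :=
  fderiv ℝ (fun x' => φ x' t) x (EuclideanSpace.single k 1)

/-- The integro-differential kernel `K(x,t,z,φ,p)`. -/
noncomputable def Kker {N l : ℕ} (η : Euc N → ℝ → Euc l → Euc N)
    (x : Euc N) (t : ℝ) (z : Euc l) (φ : Euc N → ℝ → ℝ) (p : Fin N → ℝ) : ℝ :=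
  φ (x + η x t z) t - φ x t - (if ‖z‖ ≤ 1 then ∑ k : Fin N, η x t z k * p k else 0)

/-- The exponential-polynomial weight `φ̂(x,t) = θ e^{-λt}(|x|^{2γ+2}+1)`. -/
noncomputable def weightFn (N : ℕ) (θ lam γ : ℝ) : Euc N → ℝ → ℝ :=
  fun x t => θ * Real.exp (-(lam * t)) * (‖x‖ ^ (2*γ+2 : ℝ) + 1)

/-- A power of exponent `> 1` lies above its tangent lines on the half-line. -/
lemma rpow_tangent_le {p a b : ℝ} (hp : 1 < p) (ha : 0 ≤ a) (hb : 0 ≤ b) :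
    a ^ p + p * a ^ (p - 1) * (b - a) ≤ b ^ p := by
  rcases ha.eq_or_lt with rfl | ha
  · rw [Real.zero_rpow (by linarith), Real.zero_rpow (by linarith)]
    simpa using Real.rpow_nonneg hb p
  · have h := one_add_mul_self_le_rpow_one_add (s := b / a - 1) (p := p)
      (by linarith [div_nonneg hb ha.le]) hp.le
    rw [add_sub_cancel, Real.div_rpow hb ha.le, le_div_iff₀ (Real.rpow_pos_of_pos ha p)] at h
    have e : a ^ p = a ^ (p - 1) * a := by
      rw [← Real.rpow_add_one ha.ne', sub_add_cancel]
    calc a ^ p + p * a ^ (p - 1) * (b - a) = (1 + p * (b / a - 1)) * a ^ p := by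
          rw [e]; field_simp
      _ ≤ b ^ p := h

lemma rpow_taylor_le {p a b M : ℝ} (hp : 2 < p) (ha : 0 ≤ a) (hb : 0 ≤ b)
    (haM : a ≤ M) (hbM : b ≤ M) :
    |b ^ p - a ^ p - p * a ^ (p - 1) * (b - a)| ≤ p * (p - 1) * M ^ (p - 2) * (b - a) ^ 2 := by
  have lower := rpow_tangent_le (p := p) (by linarith) ha hb
  have upper := rpow_tangent_le (p := p) (by linarith) hb ha
  have slope : (b ^ (p - 1) - a ^ (p - 1)) * (b - a) ≤ (p - 1) * M ^ (p - 2) * (b - a) ^ 2 := by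
    have h₁ := rpow_tangent_le (p := p - 1) (by linarith) ha hb
    have h₂ := rpow_tangent_le (p := p - 1) (by linarith) hb ha
    rw [show p - 1 - 1 = p - 2 by ring] at h₁ h₂
    have m₁ : a ^ (p - 2) ≤ M ^ (p - 2) := Real.rpow_le_rpow ha haM (by linarith)
    have m₂ : b ^ (p - 2) ≤ M ^ (p - 2) := Real.rpow_le_rpow hb hbM (by linarith)
    have hsq : 0 ≤ (p - 1) * (b - a) ^ 2 := mul_nonneg (by linarith) (sq_nonneg _)
    rcases le_total a b with hab | hab
    · nlinarith [mul_le_mul_of_nonneg_right h₂ (sub_nonneg.2 hab),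
        mul_le_mul_of_nonneg_left m₂ hsq]
    · nlinarith [mul_le_mul_of_nonneg_right h₁ (sub_nonneg.2 hab),
        mul_le_mul_of_nonneg_left m₁ hsq]
  rw [abs_of_nonneg (by linarith)]
  nlinarith [mul_le_mul_of_nonneg_left slope (show 0 ≤ p by linarith)]

lemma norm_rpow_taylor_le {E : Type*} [NormedAddCommGroup E] [InnerProductSpace ℝ E]
    {p M : ℝ} (hp : 2 < p) (x h : E) (hxM : ‖x‖ ≤ M) (hyM : ‖x + h‖ ≤ M) :
    |‖x + h‖ ^ p - ‖x‖ ^ p - p * ‖x‖ ^ (p - 2) * inner ℝ x h| ≤ p ^ 2 * M ^ (p - 2) * ‖h‖ ^ 2 := by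
  have radial := rpow_taylor_le hp (norm_nonneg x) (norm_nonneg (x + h)) hxM hyM
  have diff_sq : (‖x + h‖ - ‖x‖) ^ 2 ≤ ‖h‖ ^ 2 := by
    rw [sq_le_sq, abs_norm]
    simpa using abs_norm_sub_norm_le (x + h) x
  have expand := norm_add_sq_real x h
  have cauchy : inner ℝ x h ≤ ‖x‖ * ‖x + h‖ - ‖x‖ ^ 2 := by
    have := real_inner_le_norm x (x + h)
    rw [inner_add_right, real_inner_self_eq_norm_sq] at this
    linarith
  have e : ‖x‖ ^ (p - 1) = ‖x‖ ^ (p - 2) * ‖x‖ := by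
    rw [← Real.rpow_add_one' (norm_nonneg x) (by linarith)]
    ring_nf
  have hM : 0 ≤ M ^ (p - 2) := Real.rpow_nonneg ((norm_nonneg x).trans hxM) _
  have angular : |p * ‖x‖ ^ (p - 1) * (‖x + h‖ - ‖x‖) - p * ‖x‖ ^ (p - 2) * inner ℝ x h|
      ≤ p * M ^ (p - 2) * (‖h‖ ^ 2 / 2) := by
    have hpx : 0 ≤ p * ‖x‖ ^ (p - 2) :=
      mul_nonneg (by linarith) (Real.rpow_nonneg (norm_nonneg x) _)
    rw [e, show p * (‖x‖ ^ (p - 2) * ‖x‖) * (‖x + h‖ - ‖x‖) - p * ‖x‖ ^ (p - 2) * inner ℝ x h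
      = p * ‖x‖ ^ (p - 2) * (‖x‖ * ‖x + h‖ - ‖x‖ ^ 2 - inner ℝ x h) by ring,
      abs_of_nonneg (mul_nonneg hpx (by linarith))]
    have hmono : ‖x‖ ^ (p - 2) ≤ M ^ (p - 2) :=
      Real.rpow_le_rpow (norm_nonneg x) hxM (by linarith)
    exact mul_le_mul (mul_le_mul_of_nonneg_left hmono (by linarith))
      (by nlinarith [sq_nonneg (‖x + h‖ - ‖x‖)]) (by linarith)
      (mul_nonneg (by linarith) hM)
  have split := abs_sub_le (‖x + h‖ ^ p - ‖x‖ ^ p) (p * ‖x‖ ^ (p - 1) * (‖x + h‖ - ‖x‖))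
    (p * ‖x‖ ^ (p - 2) * inner ℝ x h)
  have hpM : 0 ≤ p * M ^ (p - 2) := mul_nonneg (by linarith) hM
  have radial' := mul_le_mul_of_nonneg_left diff_sq
    (mul_nonneg hpM (show 0 ≤ p - 1 by linarith))
  nlinarith [mul_nonneg hpM (sq_nonneg ‖h‖)]

lemma add_rpow_le_mul_rpow_add_one {a H p : ℝ} (ha : 0 ≤ a) (hH : 1 ≤ H) (hp : 0 ≤ p) :
    (a + H) ^ p ≤ (2 * H) ^ p * (a ^ p + 1) := by
  have hap := Real.rpow_nonneg ha p
  have hHp := Real.rpow_nonneg (show 0 ≤ 2 * H by linarith) p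
  rcases le_total a 1 with h | h
  · have := Real.rpow_le_rpow (by linarith) (show a + H ≤ 2 * H by linarith) hp
    nlinarith
  · have := Real.rpow_le_rpow (by linarith) (show a + H ≤ 2 * H * a by nlinarith) hp
    rw [Real.mul_rpow (by linarith) ha] at this
    nlinarith

lemma Euc.norm_le_of_abs_apply_le {N : ℕ} {v : Euc N} {r : ℝ} (hr : 0 ≤ r)
    (hv : ∀ k, |v k| ≤ r) : ‖v‖ ≤ (N + 1) * r := by
  refine abs_le_of_sq_le_sq' ?_ (by positivity) |>.2
  rw [EuclideanSpace.real_norm_sq_eq]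
  have : ∑ k, v k ^ 2 ≤ N * r ^ 2 := by
    simpa using Finset.sum_le_sum fun k (_ : k ∈ Finset.univ) =>
      sq_le_sq.2 ((hv k).trans (le_abs_self r))
  nlinarith [sq_nonneg r, mul_nonneg (Nat.cast_nonneg (α := ℝ) N) (sq_nonneg r),
    mul_nonneg (sq_nonneg (N : ℝ)) (sq_nonneg r)]

lemma sum_mul_pd1 {N : ℕ} (φ : Euc N → ℝ → ℝ) (x h : Euc N) (t : ℝ) :
    ∑ k, h k * pd1 φ x t k = fderiv ℝ (fun y => φ y t) x h := by
  conv_rhs => rw [← (EuclideanSpace.basisFun (Fin N) ℝ).sum_repr h]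
  simp [pd1]

lemma sum_mul_pd1_weightFn {N : ℕ} {θ lam γ : ℝ} (hγ : 0 < γ) (x h : Euc N) (t : ℝ) :
    ∑ k, h k * pd1 (weightFn N θ lam γ) x t k =
      θ * Real.exp (-(lam * t)) * ((2 * γ + 2) * ‖x‖ ^ (2 * γ + 2 - 2) * inner ℝ x h) := by
  have hd := ((hasFDerivAt_norm_rpow x (show 1 < 2 * γ + 2 by linarith)).add_const 1).const_mul
    (θ * Real.exp (-(lam * t)))
  rw [sum_mul_pd1]
  unfold weightFn
  rw [hd.fderiv]
  simp

/-- Kernel estimate for the exponential-polynomial weight: `|K(x,t,z,φ̂,Dφ̂)| ≤ c|z|²φ̂(x,t)`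
for `0 < |z| ≤ 1` and `|K(x,t,z,φ̂,Dφ̂)| ≤ c φ̂(x,t)` for `|z| > 1`, with `c = c(N,B̃,γ)`. -/
theorem weight_kernel_estimate
    (N l : ℕ) (Bt γ : ℝ) (hB : 1 ≤ Bt) (hγ : 0 < γ) :
    ∃ c : ℝ, 1 ≤ c ∧
      ∀ (θ lam T : ℝ), 0 ≤ θ → 0 < T →
      ∀ η : Euc N → ℝ → Euc l → Euc N,
      (∀ (x : Euc N) (t : ℝ) (z : Euc l) (k : Fin N), |η x t z k| ≤ Bt * min ‖z‖ 1) →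
      ∀ (x : Euc N), ∀ t ∈ Icc (0:ℝ) T, ∀ z : Euc l, z ≠ 0 →
        (‖z‖ ≤ 1 →
          |Kker η x t z (weightFn N θ lam γ) (pd1 (weightFn N θ lam γ) x t)|
            ≤ c * ‖z‖ ^ 2 * weightFn N θ lam γ x t) ∧
        (1 < ‖z‖ →
          |Kker η x t z (weightFn N θ lam γ) (pd1 (weightFn N θ lam γ) x t)|
            ≤ c * weightFn N θ lam γ x t) := by
  set p : ℝ := 2 * γ + 2 with hp
  set H : ℝ := (N + 1) * Bt with hH
  have hN : (0 : ℝ) ≤ N := Nat.cast_nonneg N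
  have hp2 : 2 < p := by linarith
  have hH1 : 1 ≤ H := by nlinarith
  have hD : 1 ≤ (2 * H) ^ p := Real.one_le_rpow (by linarith) (by linarith)
  have hpH : 1 ≤ p ^ 2 * H ^ 2 := one_le_mul_of_one_le_of_one_le
    (one_le_pow₀ (by linarith)) (one_le_pow₀ hH1)
  refine ⟨p ^ 2 * H ^ 2 * (2 * H) ^ p, one_le_mul_of_one_le_of_one_le hpH hD, ?_⟩
  intro θ lam T hθ _ η hη x t _ z _
  have hA : 0 ≤ θ * Real.exp (-(lam * t)) := mul_nonneg hθ (Real.exp_pos _).le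
  have hηnorm : ‖η x t z‖ ≤ H * min ‖z‖ 1 := by
    rw [hH, mul_assoc]
    exact Euc.norm_le_of_abs_apply_le
      (mul_nonneg (by linarith) (le_min (norm_nonneg z) zero_le_one)) (hη x t z)
  have hηH : ‖η x t z‖ ≤ H :=
    hηnorm.trans (mul_le_of_le_one_right (by linarith) (min_le_right _ _))
  have hxη : ‖x + η x t z‖ ≤ ‖x‖ + H := (norm_add_le _ _).trans (by linarith)
  have hgrowth := add_rpow_le_mul_rpow_add_one (norm_nonneg x) hH1 (show 0 ≤ p by linarith)
  have hxp : 0 ≤ ‖x‖ ^ p := Real.rpow_nonneg (norm_nonneg x) p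
  have hbase : 1 ≤ ‖x‖ + H := by linarith [norm_nonneg x]
  constructor
  · intro hz
    have hηz : ‖η x t z‖ ^ 2 ≤ H ^ 2 * ‖z‖ ^ 2 := by
      rw [← mul_pow]
      exact pow_le_pow_left₀ (norm_nonneg _) (hηnorm.trans
        (mul_le_mul_of_nonneg_left (min_le_left _ _) (by linarith))) 2
    have htaylor := norm_rpow_taylor_le hp2 x (η x t z) (by linarith) hxη
    have hpow : (‖x‖ + H) ^ (p - 2) ≤ (2 * H) ^ p * (‖x‖ ^ p + 1) :=
      (Real.rpow_le_rpow_of_exponent_le hbase (by linarith)).trans hgrowth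
    rw [Kker, if_pos hz, sum_mul_pd1_weightFn hγ]
    simp only [weightFn, ← hp]
    rw [← mul_sub, ← mul_sub, abs_mul, abs_of_nonneg hA, add_sub_add_right_eq_sub]
    calc _ ≤ θ * Real.exp (-(lam * t)) *
          (p ^ 2 * ((2 * H) ^ p * (‖x‖ ^ p + 1)) * (H ^ 2 * ‖z‖ ^ 2)) := by
          refine mul_le_mul_of_nonneg_left (htaylor.trans ?_) hA
          gcongr
      _ = _ := by ring
  · intro hz
    have hy : ‖x + η x t z‖ ^ p ≤ (‖x‖ + H) ^ p :=
      Real.rpow_le_rpow (norm_nonneg _) hxη (by linarith)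
    have hx : ‖x‖ ^ p ≤ (‖x‖ + H) ^ p :=
      Real.rpow_le_rpow (norm_nonneg _) (by linarith) (by linarith)
    rw [Kker, if_neg hz.not_ge, sub_zero]
    simp only [weightFn, ← hp]
    rw [← mul_sub, abs_mul, abs_of_nonneg hA, add_sub_add_right_eq_sub]
    calc _ ≤ θ * Real.exp (-(lam * t)) * ((2 * H) ^ p * (‖x‖ ^ p + 1)) := by
          refine mul_le_mul_of_nonneg_left (le_trans ?_ hgrowth) hA
          have hyp : 0 ≤ ‖x + η x t z‖ ^ p := Real.rpow_nonneg (norm_nonneg _) p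
          exact abs_sub_le_of_nonneg_of_le hyp hy hxp hx
      _ ≤ θ * Real.exp (-(lam * t)) *
          (p ^ 2 * H ^ 2 * ((2 * H) ^ p * (‖x‖ ^ p + 1))) :=
          mul_le_mul_of_nonneg_left (le_mul_of_one_le_left (by positivity) hpH) hA
      _ = _ := by ring

end
end

section
/- Non-local operator bound on the explicit barrier: Let T > 0, ν a positive Radon measure on ℝ^l∖{0} with ∫_{0<|z|≤1}|z|² ν(dz) + ν({|z| > 1}) ≤ Ã for some Ã ≥ 1, and η : ℝ^N×ℝ×ℝ^l → ℝ^N Borel in z with |η_k(x,t,z)| ≤ B̃ min{|z|,1} for some B̃ ≥ 1. Let c₀ ∈ C^{1,2}(ℝ^N×[0,T)) satisfy ∂_{x_k}c₀ ∈ L^∞(ℝ^N×[0,T]) and |∂_{x_k x_l}c₀(x,t)|(1+|x|²) ≤ Ã(1+|x|) for all k, l and (x,t). Fix y ∈ ℝ^N, g₀ ∈ ℝ, L ≥ 0, λ ≥ 0, K ≥ 0, ε ∈ (0,1), and define w(x,t) = g₀ + (K/ε²)(T−t) + L(e^{λ(T−t)} + 1)(|x−y|² + ε)^{1/2} + c₀(x,t).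 Then w(·,t) is twice continuously differentiable in x, and there exists a constant c ≥ 1, depending only on N, B̃, Ã and L but independent of K, ε, y, g₀, x and t, such that |I(x,t,w)| = |∫_{ℝ^l∖{0}} [w(x+η(x,t,z),t) − w(x,t) − 1_{{|z|≤1}}(z)·Σ_{k=1}^N η_k(x,t,z)∂_{x_k}w(x,t)] ν(dz)| ≤ (c/ε²)(e^{λ(T−t)} + 1) for all (x,t) ∈ ℝ^N×[0,T]. -/
open Set MeasureTheory

noncomputable section

/-- Second spatial partial derivative `∂_{x_k x_m} φ(x,t)`. -/
noncomputable def pd2 {N : ℕ} (φ : Euc N → ℝ → ℝ) (x : Euc N) (t : ℝ) (k m : Fin N) : ℝ :=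
  fderiv ℝ (fun x' => pd1 φ x' t m) x (EuclideanSpace.single k 1)

/-- The explicit barrier
`w(x,t) = g₀ + (K/ε²)(T-t) + L(e^{λ(T-t)}+1)(|x-y|²+ε)^{1/2} + c₀(x,t)`. -/
noncomputable def barrierW {N : ℕ} (T g00 L K lam ε : ℝ) (y : Euc N)
    (c₀ : Euc N → ℝ → ℝ) (x : Euc N) (t : ℝ) : ℝ :=
  g00 + (K/ε^2) * (T - t) + L * (Real.exp (lam * (T - t)) + 1) * Real.sqrt (‖x - y‖^2 + ε)
    + c₀ x t

lemma clm_apply_eq_sum_single {N : ℕ} (A : Euc N →L[ℝ] ℝ) (v : Euc N) :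
    A v = ∑ k : Fin N, v k * A (EuclideanSpace.single k 1) := by
  conv_lhs => rw [← (EuclideanSpace.basisFun (Fin N) ℝ).sum_repr v]
  simp

lemma norm_clm_le_of_abs_apply_single_le {N : ℕ} (A : Euc N →L[ℝ] ℝ) {C : ℝ} (hC : 0 ≤ C)
    (h : ∀ k, |A (EuclideanSpace.single k 1)| ≤ C) : ‖A‖ ≤ N * C := by
  refine A.opNorm_le_bound (by positivity) fun v => ?_
  rw [clm_apply_eq_sum_single A v]
  calc ‖∑ k, v k * A (EuclideanSpace.single k 1)‖
      ≤ ∑ k, ‖v k * A (EuclideanSpace.single k 1)‖ := norm_sum_le _ _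
    _ ≤ ∑ _k : Fin N, ‖v‖ * C := by
        refine Finset.sum_le_sum fun k _ => ?_
        rw [norm_mul]
        exact mul_le_mul (PiLp.norm_apply_le v k) (h k) (norm_nonneg _) (norm_nonneg _)
    _ = N * C * ‖v‖ := by simp; ring

lemma norm_le_card_mul_of_abs_apply_le {N : ℕ} (v : Euc N) {b : ℝ}
    (h : ∀ k, |v k| ≤ b) : ‖v‖ ≤ N * b := by
  conv_lhs => rw [← (EuclideanSpace.basisFun (Fin N) ℝ).sum_repr v]
  refine (norm_sum_le _ _).trans ?_
  calc ∑ k, ‖(EuclideanSpace.basisFun (Fin N) ℝ).repr v k • EuclideanSpace.basisFun (Fin N) ℝ k‖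
      ≤ ∑ _k : Fin N, b := by
        refine Finset.sum_le_sum fun k _ => ?_
        simpa [norm_smul] using h k
    _ = N * b := by simp

/-- The smoothed distance `(‖x - y‖² + ε)^{1/2}` has a quadratic Taylor remainder. -/
lemma abs_sqrt_norm_sq_add_taylor_le {N : ℕ} {ε : ℝ} (hε : ε ∈ Ioo (0 : ℝ) 1) (u h : Euc N) :
    |√(‖u + h‖ ^ 2 + ε) - √(‖u‖ ^ 2 + ε) - inner ℝ u h / √(‖u‖ ^ 2 + ε)| ≤ ‖h‖ ^ 2 / ε ^ 2 := by
  obtain ⟨h0, h1⟩ := hε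
  have hexp : ‖u + h‖ ^ 2 = ‖u‖ ^ 2 + 2 * inner ℝ u h + ‖h‖ ^ 2 := norm_add_sq_real u h
  have hcs : (inner ℝ u h) ^ 2 ≤ ‖u‖ ^ 2 * ‖h‖ ^ 2 := by
    rw [← mul_pow]
    exact sq_le_sq' (by linarith [neg_le_of_abs_le (abs_real_inner_le_norm u h)])
      (real_inner_le_norm u h)
  have ha2 : √(‖u‖ ^ 2 + ε) ^ 2 = ‖u‖ ^ 2 + ε := Real.sq_sqrt (by positivity)
  have hb2 : √(‖u + h‖ ^ 2 + ε) ^ 2 = ‖u + h‖ ^ 2 + ε := Real.sq_sqrt (by positivity)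
  have ha : 0 < √(‖u‖ ^ 2 + ε) := Real.sqrt_pos.2 (by positivity)
  have hb : 0 < √(‖u + h‖ ^ 2 + ε) := Real.sqrt_pos.2 (by positivity)
  set a := √(‖u‖ ^ 2 + ε)
  set b := √(‖u + h‖ ^ 2 + ε)
  set p : ℝ := inner ℝ u h
  have haε : ε ^ 2 ≤ a := by
    refine Real.le_sqrt_of_sq_le ?_
    have : ε ^ 4 ≤ ε := pow_le_of_le_one h0.le h1.le (by norm_num)
    nlinarith [sq_nonneg ‖u‖]
  have hlow : a ^ 2 + p ≤ a * b := by
    refine le_of_sq_le_sq ?_ (by positivity)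
    rw [mul_pow, hb2, hexp]
    nlinarith [sq_nonneg ‖h‖, mul_nonneg h0.le (sq_nonneg ‖h‖)]
  have hup : a * b ≤ a ^ 2 + p + ‖h‖ ^ 2 := by
    nlinarith [sq_nonneg (a - b), sq_nonneg ‖h‖]
  have hrem : b - a - p / a = (a * b - a ^ 2 - p) / a := by field_simp
  rw [hrem, abs_of_nonneg (div_nonneg (by linarith) ha.le)]
  calc (a * b - a ^ 2 - p) / a ≤ ‖h‖ ^ 2 / a := by gcongr; linarith
    _ ≤ ‖h‖ ^ 2 / ε ^ 2 := by gcongr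

lemma abs_sqrt_norm_sq_add_sub_le {N : ℕ} {ε : ℝ} (hε : 0 < ε) (u h : Euc N) :
    |√(‖u + h‖ ^ 2 + ε) - √(‖u‖ ^ 2 + ε)| ≤ ‖h‖ := by
  have key : ∀ u h : Euc N, √(‖u + h‖ ^ 2 + ε) ≤ √(‖u‖ ^ 2 + ε) + ‖h‖ := fun u h => by
    refine Real.sqrt_le_iff.2 ⟨by positivity, ?_⟩
    have h2 : √(‖u‖ ^ 2 + ε) ^ 2 = ‖u‖ ^ 2 + ε := Real.sq_sqrt (by positivity)
    have h3 : ‖u‖ ≤ √(‖u‖ ^ 2 + ε) := Real.le_sqrt_of_sq_le (by linarith)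
    have h4 : ‖u + h‖ ^ 2 ≤ (‖u‖ + ‖h‖) ^ 2 := by gcongr; exact norm_add_le u h
    nlinarith [mul_le_mul_of_nonneg_right h3 (norm_nonneg h)]
  have h1 := key u h
  have h2 := key (u + h) (-h)
  rw [add_neg_cancel_right, norm_neg] at h2
  exact abs_le.2 ⟨by linarith, by linarith⟩

lemma hasFDerivAt_sqrt_norm_sub_sq_add {N : ℕ} {ε : ℝ} (hε : 0 < ε) (x y : Euc N) :
    HasFDerivAt (fun x' : Euc N => √(‖x' - y‖ ^ 2 + ε))
      ((1 / √(‖x - y‖ ^ 2 + ε)) • innerSL ℝ (x - y)) x := by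
  have h := ((((hasFDerivAt_id x).sub_const y).norm_sq).add_const ε).sqrt
    (by simp only [id]; positivity)
  refine h.congr_fderiv ?_
  ext v
  have : √(‖x - y‖ ^ 2 + ε) ≠ 0 := (Real.sqrt_pos.2 (by positivity)).ne'
  simp
  field_simp

lemma contDiff_sqrt_norm_sub_sq_add {N : ℕ} {ε : ℝ} (hε : 0 < ε) (y : Euc N) {n : WithTop ℕ∞} :
    ContDiff ℝ n (fun x : Euc N => √(‖x - y‖ ^ 2 + ε)) :=
  (((contDiff_id.sub contDiff_const).norm_sq ℝ).add contDiff_const).sqrt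
    fun x => by simp only [id]; positivity

lemma abs_sub_le_of_abs_partial_le {N : ℕ} {f : Euc N → ℝ} (hf : Differentiable ℝ f) {C : ℝ}
    (hC : 0 ≤ C) (h1 : ∀ k x, |fderiv ℝ f x (EuclideanSpace.single k 1)| ≤ C) (x h : Euc N) :
    |f (x + h) - f x| ≤ N * C * ‖h‖ := by
  have := convex_univ.norm_image_sub_le_of_norm_fderiv_le (𝕜 := ℝ) (f := f)
    (fun z _ => hf z) (fun z _ => norm_clm_le_of_abs_apply_single_le _ hC fun k => h1 k z)
    (mem_univ x) (mem_univ (x + h))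
  simpa using this

lemma abs_taylor_le_of_abs_second_partial_le {N : ℕ} {f : Euc N → ℝ} (hf : ContDiff ℝ 2 f) {C : ℝ}
    (hC : 0 ≤ C)
    (h2 : ∀ k m x, |fderiv ℝ (fun x' => fderiv ℝ f x' (EuclideanSpace.single m 1)) x
      (EuclideanSpace.single k 1)| ≤ C) (x h : Euc N) :
    |f (x + h) - f x - fderiv ℝ f x h| ≤ N * (N * C * ‖h‖) * ‖h‖ := by
  have hd : Differentiable ℝ (fderiv ℝ f) :=
    (hf.fderiv_right (m := 1) (by norm_num)).differentiable (by norm_num)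
  have hpd : ∀ m, Differentiable ℝ fun x' => fderiv ℝ f x' (EuclideanSpace.single m 1) :=
    fun m => hd.clm_apply (differentiable_const _)
  have hbound : ∀ z ∈ Metric.closedBall x ‖h‖, ‖fderiv ℝ f z - fderiv ℝ f x‖ ≤
      N * (N * C * ‖h‖) := fun z hz => by
    refine norm_clm_le_of_abs_apply_single_le _ (by positivity) fun m => ?_
    have := abs_sub_le_of_abs_partial_le (hpd m) hC (fun k => h2 k m) x (z - x)
    rw [add_sub_cancel] at this
    refine this.trans ?_
    gcongr
    exact mem_closedBall_iff_norm.1 hz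
  have := (convex_closedBall x ‖h‖).norm_image_sub_le_of_norm_fderiv_le' (𝕜 := ℝ) (f := f)
    (fun z _ => hf.differentiable (by norm_num) z) hbound
    (Metric.mem_closedBall_self (norm_nonneg h)) (y := x + h) (by simp)
  simpa using this

/-- `min{‖z‖,1}²` is integrable, with integral at most `∫_{0<‖z‖≤1}‖z‖² + ν(‖z‖>1)`. -/
lemma integrableOn_min_norm_one_sq {l : ℕ} {ν : Measure (Euc l)}
    (hs : IntegrableOn (fun z : Euc l => ‖z‖ ^ 2) {z | 0 < ‖z‖ ∧ ‖z‖ ≤ 1} ν)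
    (hb : ν {z : Euc l | 1 < ‖z‖} ≠ ⊤) :
    IntegrableOn (fun z : Euc l => min ‖z‖ 1 ^ 2) {z | z ≠ 0} ν ∧
      ∫ z in {z : Euc l | z ≠ 0}, min ‖z‖ 1 ^ 2 ∂ν =
        (∫ z in {z : Euc l | 0 < ‖z‖ ∧ ‖z‖ ≤ 1}, ‖z‖ ^ 2 ∂ν)
          + (ν {z : Euc l | 1 < ‖z‖}).toReal := by
  have hS : MeasurableSet {z : Euc l | 0 < ‖z‖ ∧ ‖z‖ ≤ 1} :=
    (measurableSet_lt measurable_const measurable_norm).inter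
      (measurableSet_le measurable_norm measurable_const)
  have hB : MeasurableSet {z : Euc l | 1 < ‖z‖} := measurableSet_lt measurable_const measurable_norm
  have hunion : {z : Euc l | z ≠ 0} = {z | 0 < ‖z‖ ∧ ‖z‖ ≤ 1} ∪ {z | 1 < ‖z‖} := by
    ext z
    simp only [mem_ofPred_eq, mem_union, ← norm_pos_iff]
    constructor
    · intro h
      exact (le_or_gt ‖z‖ 1).imp (fun h' => ⟨h, h'⟩) id
    · rintro (h | h)
      · exact h.1
      · linarith
  have hdisj : Disjoint {z : Euc l | 0 < ‖z‖ ∧ ‖z‖ ≤ 1} {z | 1 < ‖z‖} :=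
    Set.disjoint_left.2 fun z h h' => absurd h.2 (not_le.2 h')
  have eS : EqOn (fun z : Euc l => ‖z‖ ^ 2) (fun z => min ‖z‖ 1 ^ 2) {z | 0 < ‖z‖ ∧ ‖z‖ ≤ 1} :=
    fun z hz => by simp [min_eq_left hz.2]
  have eB : EqOn (fun _ : Euc l => (1 : ℝ)) (fun z => min ‖z‖ 1 ^ 2) {z | 1 < ‖z‖} :=
    fun z (hz : 1 < ‖z‖) => by simp [min_eq_right hz.le]
  have iS := hs.congr_fun eS hS
  have iB : IntegrableOn (fun z : Euc l => min ‖z‖ 1 ^ 2) {z | 1 < ‖z‖} ν :=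
    (integrableOn_const hb).congr_fun eB hB
  rw [hunion]
  refine ⟨iS.union iB, ?_⟩
  rw [setIntegral_union hdisj hB iS iB, ← setIntegral_congr_fun hS eS,
    ← setIntegral_congr_fun hB eB]
  simp [Measure.real]

lemma hasFDerivAt_barrierW {N : ℕ} (T g00 L K lam : ℝ) {ε : ℝ} (hε : 0 < ε) (y : Euc N)
    {c₀ : Euc N → ℝ → ℝ} {x : Euc N} {t : ℝ} (hc : DifferentiableAt ℝ (fun x => c₀ x t) x) :
    HasFDerivAt (fun x => barrierW T g00 L K lam ε y c₀ x t)
      ((L * (Real.exp (lam * (T - t)) + 1)) • (1 / √(‖x - y‖ ^ 2 + ε)) • innerSL ℝ (x - y)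
        + fderiv ℝ (fun x => c₀ x t) x) x :=
  (((hasFDerivAt_sqrt_norm_sub_sq_add hε x y).const_mul _).const_add _).add hc.hasFDerivAt

lemma contDiff_barrierW {N : ℕ} (T g00 L K lam : ℝ) {ε : ℝ} (hε : 0 < ε) (y : Euc N)
    {c₀ : Euc N → ℝ → ℝ} {t : ℝ} {n : WithTop ℕ∞} (hc : ContDiff ℝ n (fun x => c₀ x t)) :
    ContDiff ℝ n (fun x => barrierW T g00 L K lam ε y c₀ x t) :=
  (contDiff_const.add (contDiff_const.mul (contDiff_sqrt_norm_sub_sq_add hε y))).add hc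

/-- Taylor bound for the barrier. -/
lemma abs_barrierW_taylor_le {N : ℕ} (T g00 K lam : ℝ) {L ε C : ℝ} (hL : 0 ≤ L)
    (hε : ε ∈ Ioo (0 : ℝ) 1) (y : Euc N) {c₀ : Euc N → ℝ → ℝ} {t : ℝ}
    (hc : ContDiff ℝ 2 (fun x => c₀ x t)) (hC : 0 ≤ C) (h2 : ∀ k m x, |pd2 c₀ x t k m| ≤ C)
    (x h : Euc N) :
    |barrierW T g00 L K lam ε y c₀ (x + h) t - barrierW T g00 L K lam ε y c₀ x t
        - ∑ k, h k * pd1 (barrierW T g00 L K lam ε y c₀) x t k|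
      ≤ (L + N ^ 2 * C) / ε ^ 2 * (Real.exp (lam * (T - t)) + 1) * ‖h‖ ^ 2 := by
  have hderiv := hasFDerivAt_barrierW T g00 L K lam hε.1 y (hc.differentiable (by norm_num) x)
  have hsum := clm_apply_eq_sum_single
    (fderiv ℝ (fun x => barrierW T g00 L K lam ε y c₀ x t) x) h
  have hpsi := abs_sqrt_norm_sq_add_taylor_le hε (x - y) h
  have hc0 := abs_taylor_le_of_abs_second_partial_le hc hC h2 x h
  have hshift : x + h - y = x - y + h := by abel
  have hE : 1 ≤ Real.exp (lam * (T - t)) + 1 := by linarith [Real.exp_pos (lam * (T - t))]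
  simp only [pd1]
  rw [← hsum, hderiv.fderiv]
  simp only [barrierW, hshift, add_apply, smul_apply,
    innerSL_apply_apply, smul_eq_mul]
  set E := Real.exp (lam * (T - t)) + 1
  have hε2 : ε ^ 2 ≤ 1 := pow_le_one₀ hε.1.le hε.2.le
  have hε2' : 0 < ε ^ 2 := pow_pos hε.1 2
  have hE' : 1 ≤ E / ε ^ 2 := by rw [le_div_iff₀ hε2']; linarith
  set R := √(‖x - y + h‖ ^ 2 + ε) - √(‖x - y‖ ^ 2 + ε) - inner ℝ (x - y) h / √(‖x - y‖ ^ 2 + ε)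
    with hR
  set S := c₀ (x + h) t - c₀ x t - fderiv ℝ (fun x => c₀ x t) x h with hS
  calc _ = |L * E * R + S| := by rw [hR, hS]; congr 1; ring
    _ ≤ L * E * (‖h‖ ^ 2 / ε ^ 2) + N * (N * C * ‖h‖) * ‖h‖ * 1 := by
        refine (abs_add_le _ _).trans (add_le_add ?_ (by simpa using hc0))
        rw [abs_mul, abs_of_nonneg (by positivity : 0 ≤ L * E)]
        gcongr
    _ ≤ L * E * (‖h‖ ^ 2 / ε ^ 2) + N * (N * C * ‖h‖) * ‖h‖ * (E / ε ^ 2) := by gcongr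
    _ = _ := by ring

/-- Lipschitz bound for the barrier. -/
lemma abs_barrierW_sub_le {N : ℕ} (T g00 K lam : ℝ) {L ε C : ℝ} (hL : 0 ≤ L)
    (hε : ε ∈ Ioo (0 : ℝ) 1) (y : Euc N) {c₀ : Euc N → ℝ → ℝ} {t : ℝ}
    (hc : Differentiable ℝ (fun x => c₀ x t)) (hC : 0 ≤ C) (h1 : ∀ k x, |pd1 c₀ x t k| ≤ C)
    (x h : Euc N) :
    |barrierW T g00 L K lam ε y c₀ (x + h) t - barrierW T g00 L K lam ε y c₀ x t|
      ≤ (L + N * C) / ε ^ 2 * (Real.exp (lam * (T - t)) + 1) * ‖h‖ := by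
  have hpsi := abs_sqrt_norm_sq_add_sub_le hε.1 (x - y) h
  have hc0 := abs_sub_le_of_abs_partial_le hc hC h1 x h
  have hshift : x + h - y = x - y + h := by abel
  have hE : 1 ≤ Real.exp (lam * (T - t)) + 1 := by linarith [Real.exp_pos (lam * (T - t))]
  simp only [barrierW, hshift]
  set E := Real.exp (lam * (T - t)) + 1
  have hε2 : ε ^ 2 ≤ 1 := pow_le_one₀ hε.1.le hε.2.le
  have hε2' : 0 < ε ^ 2 := pow_pos hε.1 2
  have hε1 : 1 ≤ 1 / ε ^ 2 := by rw [le_div_iff₀ hε2']; linarith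
  have hE' : 1 ≤ E / ε ^ 2 := by rw [le_div_iff₀ hε2']; linarith
  set R := √(‖x - y + h‖ ^ 2 + ε) - √(‖x - y‖ ^ 2 + ε) with hR
  set S := c₀ (x + h) t - c₀ x t with hS
  calc _ = |L * E * R + S| := by rw [hR, hS]; congr 1; ring
    _ ≤ L * E * ‖h‖ * 1 + N * C * ‖h‖ * 1 := by
        rw [mul_one, mul_one]
        refine (abs_add_le _ _).trans (add_le_add ?_ hc0)
        rw [abs_mul, abs_of_nonneg (by positivity : 0 ≤ L * E)]
        gcongr
    _ ≤ L * E * ‖h‖ * (1 / ε ^ 2) + N * C * ‖h‖ * (E / ε ^ 2) := by gcongr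
    _ = _ := by ring

lemma measurable_Kker {N l : ℕ} {η : Euc N → ℝ → Euc l → Euc N} {x : Euc N} {t : ℝ}
    (hη : Measurable (fun z => η x t z)) {φ : Euc N → ℝ → ℝ} (hφ : Continuous fun x => φ x t)
    (p : Fin N → ℝ) : Measurable (fun z => Kker η x t z φ p) := by
  have hcomp : ∀ k, Measurable fun z => η x t z k := fun k =>
    (EuclideanSpace.proj (𝕜 := ℝ) k).continuous.measurable.comp hη
  refine ((hφ.measurable.comp (measurable_const.add hη)).sub measurable_const).sub ?_
  exact Measurable.ite (measurableSet_le measurable_norm measurable_const)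
    (Finset.measurable_sum _ fun k _ => (hcomp k).mul_const _) measurable_const

lemma abs_Kker_barrierW_le {N l : ℕ} (T g00 K lam : ℝ) {L ε C₁ C₂ Bt : ℝ} (hL : 0 ≤ L)
    (hε : ε ∈ Ioo (0 : ℝ) 1) (y : Euc N) {c₀ : Euc N → ℝ → ℝ} {t : ℝ}
    (hc : ContDiff ℝ 2 (fun x => c₀ x t)) (hC₁ : 0 ≤ C₁) (hC₂ : 0 ≤ C₂) (hB : 0 ≤ Bt)
    (h1 : ∀ k x, |pd1 c₀ x t k| ≤ C₁) (h2 : ∀ k m x, |pd2 c₀ x t k m| ≤ C₂)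
    {η : Euc N → ℝ → Euc l → Euc N} {x : Euc N} {z : Euc l}
    (hη : ∀ k, |η x t z k| ≤ Bt * min ‖z‖ 1) :
    |Kker η x t z (barrierW T g00 L K lam ε y c₀) (pd1 (barrierW T g00 L K lam ε y c₀) x t)|
      ≤ ((L + N ^ 2 * C₂) * (N * Bt) ^ 2 + (L + N * C₁) * (N * Bt)) / ε ^ 2
        * (Real.exp (lam * (T - t)) + 1) * min ‖z‖ 1 ^ 2 := by
  have hnorm := norm_le_card_mul_of_abs_apply_le _ hη
  have hE : 0 < Real.exp (lam * (T - t)) + 1 := by positivity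
  have hε2 : 0 < ε ^ 2 := pow_pos hε.1 2
  have hmin : 0 ≤ min ‖z‖ 1 := by positivity
  have htaylor := abs_barrierW_taylor_le T g00 K lam hL hε y hc hC₂ h2 x (η x t z)
  have hlip := abs_barrierW_sub_le T g00 K lam hL hε y (hc.differentiable (by norm_num)) hC₁ h1
    x (η x t z)
  unfold Kker
  set E := Real.exp (lam * (T - t)) + 1
  split_ifs with hz
  · refine htaylor.trans ?_
    calc _ ≤ (L + N ^ 2 * C₂) / ε ^ 2 * E * (N * (Bt * min ‖z‖ 1)) ^ 2 := by gcongr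
      _ = (L + N ^ 2 * C₂) * (N * Bt) ^ 2 / ε ^ 2 * E * min ‖z‖ 1 ^ 2 := by ring
      _ ≤ _ := by
        gcongr
        exact le_add_of_nonneg_right (by positivity)
  · rw [sub_zero]
    refine hlip.trans ?_
    rw [min_eq_right (not_le.1 hz).le] at hnorm ⊢
    calc _ ≤ (L + N * C₁) / ε ^ 2 * E * (N * (Bt * 1)) := by gcongr
      _ = (L + N * C₁) * (N * Bt) / ε ^ 2 * E * 1 ^ 2 := by ring
      _ ≤ _ := by
        gcongr
        exact le_add_of_nonneg_left (by positivity)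

lemma le_two_mul_of_mul_one_add_sq_le {a A r : ℝ} (hA : 0 ≤ A)
    (h : a * (1 + r ^ 2) ≤ A * (1 + r)) : a ≤ 2 * A := by
  by_contra! hlt
  nlinarith [mul_lt_mul_of_pos_right hlt (by positivity : 0 < 1 + r ^ 2),
    mul_nonneg hA (sq_nonneg (r - 1)), mul_nonneg hA (sq_nonneg r)]

/-- Non-local operator bound on the explicit barrier: `w(·,t)` is twice continuously
differentiable in `x` and `|I(x,t,w)| ≤ (c/ε²)(e^{λ(T-t)}+1)`, with `c` independent of
`K`, `ε`, `y`, `g₀`, `x` and `t`. -/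
theorem barrier_nonlocal_bound
    (N l : ℕ) (Bt At L M : ℝ) (hB : 1 ≤ Bt) (hA : 1 ≤ At) (hL : 0 ≤ L) :
    ∃ c : ℝ, 1 ≤ c ∧
      ∀ (T lam K : ℝ), 0 < T → 0 ≤ lam → 0 ≤ K → ∀ ε ∈ Ioo (0:ℝ) 1,
      ∀ (y : Euc N) (g00 : ℝ) (ν : Measure (Euc l)),
      ν ({0} : Set (Euc l)) = 0 →
      IntegrableOn (fun z : Euc l => ‖z‖ ^ 2) {z | 0 < ‖z‖ ∧ ‖z‖ ≤ 1} ν →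
      ν {z : Euc l | 1 < ‖z‖} ≠ ⊤ →
      (∫ z in {z : Euc l | 0 < ‖z‖ ∧ ‖z‖ ≤ 1}, ‖z‖ ^ 2 ∂ν)
        + (ν {z : Euc l | 1 < ‖z‖}).toReal ≤ At →
      ∀ η : Euc N → ℝ → Euc l → Euc N,
      (∀ (x : Euc N) (t : ℝ), Measurable (fun z => η x t z)) →
      (∀ (x : Euc N) (t : ℝ) (z : Euc l) (k : Fin N), |η x t z k| ≤ Bt * min ‖z‖ 1) →
      ∀ c₀ : Euc N → ℝ → ℝ,
      (∀ t ∈ Icc (0:ℝ) T, ContDiff ℝ 2 (fun x => c₀ x t)) →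
      (∀ (k : Fin N) (x : Euc N), ∀ t ∈ Icc (0:ℝ) T, |pd1 c₀ x t k| ≤ M) →
      (∀ (k m : Fin N) (x : Euc N), ∀ t ∈ Icc (0:ℝ) T,
        |pd2 c₀ x t k m| * (1 + ‖x‖ ^ 2) ≤ At * (1 + ‖x‖)) →
      (∀ t ∈ Icc (0:ℝ) T, ContDiff ℝ 2 (fun x => barrierW T g00 L K lam ε y c₀ x t)) ∧
      ∀ (x : Euc N), ∀ t ∈ Icc (0:ℝ) T,
        IntegrableOn (fun z => Kker η x t z (barrierW T g00 L K lam ε y c₀)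
          (pd1 (barrierW T g00 L K lam ε y c₀) x t)) {z : Euc l | z ≠ 0} ν ∧
        |∫ z in {z : Euc l | z ≠ 0},
            Kker η x t z (barrierW T g00 L K lam ε y c₀)
              (pd1 (barrierW T g00 L K lam ε y c₀) x t) ∂ν|
          ≤ (c/ε^2) * (Real.exp (lam * (T - t)) + 1) := by
  have hB0 : 0 ≤ Bt := by linarith
  have hA0 : 0 ≤ At := by linarith
  set C := (L + N ^ 2 * (2 * At)) * (N * Bt) ^ 2 + (L + N * |M|) * (N * Bt) with hCdef
  have hC : 0 ≤ C := by positivity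
  refine ⟨1 + C * At, le_add_of_nonneg_right (by positivity), ?_⟩
  intro T lam K _ _ _ ε hε y g00 ν _ hs hb hν η hηm hη c₀ hc h1 h2
  refine ⟨fun t ht => contDiff_barrierW T g00 L K lam hε.1 y (hc t ht), fun x t ht => ?_⟩
  obtain ⟨hint, hval⟩ := integrableOn_min_norm_one_sq hs hb
  have hE : 0 < Real.exp (lam * (T - t)) + 1 := by positivity
  have hε2 : 0 < ε ^ 2 := pow_pos hε.1 2
  have hbound : ∀ z, ‖Kker η x t z (barrierW T g00 L K lam ε y c₀)
      (pd1 (barrierW T g00 L K lam ε y c₀) x t)‖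
        ≤ C / ε ^ 2 * (Real.exp (lam * (T - t)) + 1) * min ‖z‖ 1 ^ 2 := fun z =>
    abs_Kker_barrierW_le T g00 K lam hL hε y (hc t ht) (abs_nonneg M) (by positivity) hB0
      (fun k x => (h1 k x t ht).trans (le_abs_self M))
      (fun k m x => le_two_mul_of_mul_one_add_sq_le hA0 (h2 k m x t ht)) (hη x t z)
  have hmeas := measurable_Kker (hηm x t)
    (contDiff_barrierW T g00 L K lam hε.1 y (hc t ht)).continuous
    (pd1 (barrierW T g00 L K lam ε y c₀) x t)
  have hdom := hint.const_mul (C / ε ^ 2 * (Real.exp (lam * (T - t)) + 1))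
  refine ⟨hdom.mono' hmeas.aestronglyMeasurable (ae_of_all _ hbound), ?_⟩
  refine (norm_integral_le_of_norm_le hdom (ae_of_all _ hbound)).trans ?_
  rw [integral_const_mul, hval]
  calc _ ≤ C / ε ^ 2 * (Real.exp (lam * (T - t)) + 1) * At := by gcongr
    _ = C * At / ε ^ 2 * (Real.exp (lam * (T - t)) + 1) := by ring
    _ ≤ _ := by gcongr; linarith

end
end
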